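/- Let G=(V_∃,V_∀,E,γ_C,φ_C) be an Emerson-Lei game over a finite set C of colors, let P(G) be the parity game obtained by the later-appearance-record construction, and let π_0 be a fixed permutation of C. Then for every node v∈V, v∈Win_G if and only if (v,π_0)∈Win_{P(G)}. -/

import Mathlib

open Filter

/-- The history (list of nodes strictly before position `n`) of a play. -/
def histList {V : Type*} (p : ℕ → V) (n : ℕ) : List V := List.ofFn (fun j : Fin n => p (j : ℕ))

/-- Player ∃ wins an infinite play of a parity game iff the maximal priority
occurring infinitely often is even. -/
def ParityWinsPlay {V : Type*} (Ω : V → ℕ) (π : ℕ → V) : Prop :=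
  ∃ m, Even m ∧ (∃ᶠ i in atTop, Ω (π i) = m) ∧ ∀ q, q > m → ∀ᶠ i in atTop, Ω (π i) ≠ q

/-- Player ∃ has a winning strategy from `v`. -/
def WinsFrom {V : Type*} (Vex : Set V) (E : V → Set V) (WinPlay : (ℕ → V) → Prop)
    (v : V) : Prop :=
  ∃ σ : List V → V → V,
    (∀ (h : List V) (u : V), u ∈ Vex → (E u).Nonempty → σ h u ∈ E u) ∧
    (∀ (p : ℕ → V) (n : ℕ), p 0 = v → (∀ i, i < n → p (i+1) ∈ E (p i)) →
        (∀ i, i < n → p i ∈ Vex → p (i+1) = σ (histList p i) (p i)) →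
        p n ∈ Vex → (E (p n)).Nonempty) ∧
    (∀ π : ℕ → V, π 0 = v → (∀ i, π (i+1) ∈ E (π i)) →
        (∀ i, π i ∈ Vex → π (i+1) = σ (histList π i) (π i)) → WinPlay π)

/-- Player ∃ has a positional winning strategy from `v`. -/
def PosWinsFrom {V : Type*} (Vex : Set V) (E : V → Set V) (WinPlay : (ℕ → V) → Prop)
    (v : V) : Prop :=
  ∃ σ : V → V,
    (∀ u : V, u ∈ Vex → (E u).Nonempty → σ u ∈ E u) ∧
    (∀ (p : ℕ → V) (n : ℕ), p 0 = v → (∀ i, i < n → p (i+1) ∈ E (p i)) →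
        (∀ i, i < n → p i ∈ Vex → p (i+1) = σ (p i)) →
        p n ∈ Vex → (E (p n)).Nonempty) ∧
    (∀ π : ℕ → V, π 0 = v → (∀ i, π (i+1) ∈ E (π i)) →
        (∀ i, π i ∈ Vex → π (i+1) = σ (π i)) → WinPlay π)

/-- Boolean formulas over atoms `Inf(c)`, `c ∈ C` (with `Fin(c) = ¬ Inf(c)`). -/
inductive ELForm (C : Type*) : Type _
  | inf : C → ELForm C
  | neg : ELForm C → ELForm C
  | and : ELForm C → ELForm C → ELForm C
  | or : ELForm C → ELForm C → ELForm C

/-- Satisfaction of an Emerson-Lei formula under a valuation of the atoms `Inf(c)`. -/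
def ELForm.sat {C : Type*} (val : C → Prop) : ELForm C → Prop
  | .inf c => val c
  | .neg φ => ¬ ELForm.sat val φ
  | .and φ ψ => ELForm.sat val φ ∧ ELForm.sat val ψ
  | .or φ ψ => ELForm.sat val φ ∨ ELForm.sat val ψ

/-- A play satisfies the Emerson-Lei objective iff the formula `φ` holds when each atom
`Inf(c)` is interpreted as "`c` occurs in the coloring of infinitely many positions". -/
def ELWinsPlay {V C : Type*} (γC : V → Finset C) (φ : ELForm C) (π : ℕ → V) : Prop :=
  ELForm.sat (fun c => ∃ᶠ i in atTop, c ∈ γC (π i)) φ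

/-- `l` is an ordering (permutation) of the finite set `C`. -/
def IsOrdering {C : Type*} (l : List C) : Prop := l.Nodup ∧ ∀ c : C, c ∈ l

/-- `larUpd l D` is `l@D`: the element of `D` occurring at the rightmost position of `l`
is moved to the front of `l` (and `l@∅ = l`). -/
def larUpd {C : Type*} [DecidableEq C] (l : List C) (D : Finset C) : List C :=
  match (l.filter fun c => decide (c ∈ D)).getLast? with
  | none => l
  | some c => c :: l.erase c

/-- `larPos l D` is the rightmost (1-based) position of `l` containing an element of `D`
(and `0` if there is none). -/
def larPos {C : Type*} [DecidableEq C] (l : List C) (D : Finset C) : ℕ :=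
  match (l.filter fun c => decide (c ∈ D)).getLast? with
  | none => 0
  | some c => l.idxOf c + 1

/-- The priority function of the LAR parity game `P(G)`: `Ω(v,π) = 2p` if `π[p] ⊨ φ` and
`Ω(v,π) = 2p+1` otherwise, where `p` is the rightmost position of `π` containing a color
of `γ_C(v)` and `π[p]` is the set of colors at the first `p` positions of `π`. -/
noncomputable def larPrio {V C : Type*} [DecidableEq C] (γC : V → Finset C) (φ : ELForm C)
    (q : V × List C) : ℕ :=
  haveI : Decidable (ELForm.sat (fun c => c ∈ q.2.take (larPos q.2 (γC q.1))) φ) :=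
    Classical.propDecidable _
  if ELForm.sat (fun c => c ∈ q.2.take (larPos q.2 (γC q.1))) φ then
    2 * larPos q.2 (γC q.1)
  else 2 * larPos q.2 (γC q.1) + 1

/-- Nodes of `P(G)` owned by player ∃: pairs whose first component is owned by ∃ in `G`. -/
def prodVex {V : Type*} (C : Type*) (Vex : Set V) : Set (V × List C) := {q | q.1 ∈ Vex}

/-- Moves of `P(G)`: `E'(v,π) = {(w, π@γ_C(v)) ∣ (v,w) ∈ E}`. -/
def prodE {V C : Type*} [DecidableEq C] (E : V → Set V) (γC : V → Finset C)
    (q : V × List C) : Set (V × List C) :=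
  {r | ∃ w ∈ E q.1, r = (w, larUpd q.2 (γC q.1))}

theorem larAux_split {C : Type*} [DecidableEq C] (l : List C) (hl : l.Nodup) (D : Finset C) :
    ((∀ c ∈ l, c ∉ D) ∧ larPos l D = 0 ∧ larUpd l D = l) ∨
    ∃ A c B, l = A ++ c :: B ∧ c ∈ D ∧ (∀ b ∈ B, b ∉ D) ∧ larPos l D = A.length + 1 ∧
      larUpd l D = c :: (A ++ B) := by
  rcases h : (l.filter fun c => decide (c ∈ D)).getLast? with _ | c
  · left
    refine ⟨?_, by simp [larPos, h], by simp [larUpd, h]⟩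
    simpa using h
  · right
    obtain ⟨ini, hi⟩ := List.getLast?_eq_some_iff.1 h
    obtain ⟨l1, l2, rfl, h1, h2⟩ := List.filter_eq_append_iff.1 hi
    obtain ⟨m1, m2, rfl, h3, h4, h5⟩ := List.filter_eq_cons_iff.1 h2
    have hc : c ∉ l1 ++ m1 := by
      intro hc
      rw [← List.append_assoc, List.nodup_append] at hl
      exact hl.2.2 c hc c (by simp) rfl
    refine ⟨l1 ++ m1, c, m2, by simp, by simpa using h4, by simpa using h5, ?_, ?_⟩
    · simp only [larPos, h]
      rw [← List.append_assoc, List.idxOf_append_of_notMem hc]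
      simp
    · simp only [larUpd, h]
      rw [← List.append_assoc, List.erase_append_right _ hc]
      simp

theorem larAux_perm {C : Type*} [DecidableEq C] (l : List C) (hl : l.Nodup) (D : Finset C) :
    (larUpd l D).Perm l := by
  rcases larAux_split l hl D with ⟨_, _, h⟩ | ⟨A, c, B, h, _, _, _, h'⟩
  · rw [h]
  · rw [h', h]; exact List.perm_middle.symm

theorem larAux_ord {C : Type*} [DecidableEq C] (l : List C) (hl : IsOrdering l) (D : Finset C) :
    IsOrdering (larUpd l D) := by
  have h := larAux_perm l hl.1 D
  exact ⟨h.nodup_iff.2 hl.1, fun c => h.mem_iff.2 (hl.2 c)⟩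

theorem larAux_idx {C : Type*} [DecidableEq C] (l : List C) (hl : IsOrdering l) (D : Finset C)
    (c : C) :
    (c ∈ D → l.idxOf c < larPos l D) ∧
    (larPos l D ≤ l.idxOf c → (larUpd l D).idxOf c = l.idxOf c) ∧
    (l.idxOf c + 1 < larPos l D → (larUpd l D).idxOf c = l.idxOf c + 1) ∧
    (l.idxOf c + 1 = larPos l D → c ∈ D ∧ (larUpd l D).idxOf c = 0) := by
  rcases larAux_split l hl.1 D with ⟨h1, h2, h3⟩ | ⟨A, e, B, h, he, hB, h1, h2⟩
  · rw [h2, h3]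
    have := h1 c (hl.2 c)
    simp [this]
  · rw [h1, h2]
    have hn := hl.1
    have hm := hl.2 c
    rw [h] at hn hm ⊢
    have heA : e ∉ A := by
      intro hc
      rw [List.nodup_append] at hn
      exact hn.2.2 e hc e (by simp) rfl
    by_cases hcA : c ∈ A
    · have hce : e ≠ c := by rintro rfl; exact heA hcA
      have hlt := List.idxOf_lt_length_of_mem hcA
      rw [List.idxOf_append_of_mem hcA, List.idxOf_cons_ne _ hce, List.idxOf_append_of_mem hcA]
      refine ⟨fun _ => by omega, fun _ => by omega, fun _ => by omega, fun _ => by omega⟩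
    · by_cases hce : e = c
      · subst hce
        rw [List.idxOf_append_of_notMem hcA]
        simp [he]
      · have hcB : c ∈ B := by
          simp at hm; grind
        have hcD := hB c hcB
        rw [List.idxOf_append_of_notMem hcA, List.idxOf_cons_ne _ hce, List.idxOf_cons_ne _ hce,
          List.idxOf_append_of_notMem hcA]
        refine ⟨fun h => absurd h hcD, fun _ => by omega, fun _ => by omega, fun _ => by omega⟩

theorem larAux_le {C : Type*} [DecidableEq C] (l : List C) (hl : l.Nodup) (D : Finset C) :
    larPos l D ≤ l.length := by
  rcases larAux_split l hl D with ⟨_, h, _⟩ | ⟨A, c, B, h, _, _, h', _⟩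
  · omega
  · rw [h', h]; simp

theorem larAux_take {C : Type*} [DecidableEq C] (l : List C) (hl : IsOrdering l) (n : ℕ) (c : C) :
    c ∈ l.take n ↔ l.idxOf c < n := by
  have := List.mem_take_iff_idxOf_lt (hl.2 c) (n := n)
  exact this

theorem larAux_lim {C : Type*} (x : ℕ → C → ℕ) (d : ℕ → ℕ) (D : ℕ → Finset C) (N : ℕ)
    (hN : ∀ i, d i ≤ N)
    (h1 : ∀ i c, c ∈ D i → x i c < d i)
    (h2 : ∀ i c, d i ≤ x i c → x (i+1) c = x i c)
    (h3 : ∀ i c, x i c + 1 < d i → x (i+1) c = x i c + 1)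
    (h4 : ∀ i c, x i c + 1 = d i → c ∈ D i ∧ x (i+1) c = 0) :
    ∃ m, (∃ᶠ i in atTop, d i = m) ∧ (∀ᶠ i in atTop, d i ≤ m) ∧
      ∀ᶠ i in atTop, ∀ c, (x i c < m ↔ ∃ᶠ j in atTop, c ∈ D j) := by
  classical
  have hex : ∃ m, ∀ᶠ i in atTop, d i ≤ m := ⟨N, Eventually.of_forall hN⟩
  obtain ⟨m, hm, hmin⟩ : ∃ m, (∀ᶠ i in atTop, d i ≤ m) ∧ ∀ k < m, ¬ ∀ᶠ i in atTop, d i ≤ k :=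
    ⟨Nat.find hex, Nat.find_spec hex, fun k hk => Nat.find_min hex hk⟩
  have hf : ∃ᶠ i in atTop, d i = m := by
    intro hne
    rcases Nat.eq_zero_or_pos m with rfl | hpos
    · obtain ⟨i, hi, hi'⟩ := (hm.and hne).exists
      omega
    · refine hmin (m-1) (by omega) ?_
      filter_upwards [hm, hne] with i hi hi'
      omega
  refine ⟨m, hf, hm, ?_⟩
  obtain ⟨n0, hn0⟩ := eventually_atTop.1 hm
  have step : ∀ i, n0 ≤ i → ∀ c, (x (i+1) c < m ↔ x i c < m) := by
    intro i hi c
    have a := hn0 i hi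
    have b2 := h2 i c
    have b3 := h3 i c
    have b4 := h4 i c
    rcases lt_trichotomy (x i c + 1) (d i) with h | h | h
    · have := b3 h; omega
    · have := (b4 h).2; omega
    · have := b2 (by omega); omega
  have steps : ∀ i, n0 ≤ i → ∀ j, i ≤ j → ∀ c, (x j c < m ↔ x i c < m) := by
    intro i hi j hj c
    induction j, hj using Nat.le_induction with
    | base => rfl
    | succ j hj ih => rw [step j (by omega), ih]
  filter_upwards [eventually_ge_atTop n0] with i hi c
  constructor
  · intro hx
    rw [frequently_atTop]
    intro a
    by_contra hcon
    push Not at hcon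
    have mono : ∀ j, max a i ≤ j → ∀ k, j ≤ k → x j c ≤ x k c := by
      intro j hj k hk
      induction k, hk using Nat.le_induction with
      | base => rfl
      | succ k hk ih =>
        have b2 := h2 k c
        have b3 := h3 k c
        have b4 := h4 k c
        have b5 := hcon k (by omega)
        rcases lt_trichotomy (x k c + 1) (d k) with h | h | h
        · have := b3 h; omega
        · exact absurd (b4 h).1 b5
        · have := b2 (by omega); omega
    have unb : ∀ k, ∃ j, max a i ≤ j ∧ k ≤ x j c := by
      intro k
      induction k with
      | zero => exact ⟨_, le_rfl, Nat.zero_le _⟩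
      | succ k ih =>
        obtain ⟨j, hj, hk⟩ := ih
        obtain ⟨j', hj', hd⟩ := frequently_atTop.1 hf j
        have m1 := mono j hj j' hj'
        have lt := (steps i hi j' (by omega) c).2 hx
        refine ⟨j'+1, by omega, ?_⟩
        have b3 := h3 j' c
        have b4 := h4 j' c
        have b5 := hcon j' (by omega)
        rcases lt_trichotomy (x j' c + 1) (d j') with h | h | h
        · have := b3 h; omega
        · exact absurd (b4 h).1 b5
        · omega
    obtain ⟨j, hj, hk⟩ := unb m
    have lt := (steps i hi j (by omega) c).2 hx
    omega
  · intro hfr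
    obtain ⟨j, hj, hD⟩ := frequently_atTop.1 hfr i
    have := h1 j c hD
    have := hn0 j (by omega)
    exact (steps i hi j hj c).1 (by omega)

theorem larAux_play {V C : Type*} [DecidableEq C] (γC : V → Finset C) (φ : ELForm C)
    (p : ℕ → V) (L : ℕ → List C) (h0 : IsOrdering (L 0))
    (hL : ∀ i, L (i+1) = larUpd (L i) (γC (p i))) :
    ELWinsPlay γC φ p ↔ ParityWinsPlay (larPrio γC φ) (fun i => (p i, L i)) := by
  have hord : ∀ i, IsOrdering (L i) := by
    intro i
    induction i with
    | zero => exact h0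
    | succ i ih => rw [hL]; exact larAux_ord _ ih _
  have hlen : ∀ i, (L i).length = (L 0).length := by
    intro i
    induction i with
    | zero => rfl
    | succ i ih => rw [hL, (larAux_perm _ (hord i).1 _).length_eq, ih]
  obtain ⟨m, hf, hle, hlim⟩ := larAux_lim (fun i c => (L i).idxOf c)
    (fun i => larPos (L i) (γC (p i))) (fun i => γC (p i)) (L 0).length
    (fun i => (larAux_le _ (hord i).1 _).trans (hlen i).le)
    (fun i c => (larAux_idx _ (hord i) _ c).1)
    (fun i c => by rw [hL]; exact (larAux_idx _ (hord i) _ c).2.1)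
    (fun i c => by rw [hL]; exact (larAux_idx _ (hord i) _ c).2.2.1)
    (fun i c => by rw [hL]; exact (larAux_idx _ (hord i) _ c).2.2.2)
  have key : ∀ᶠ i in atTop, larPos (L i) (γC (p i)) = m →
      (ELForm.sat (fun c => c ∈ (L i).take (larPos (L i) (γC (p i)))) φ ↔ ELWinsPlay γC φ p) := by
    filter_upwards [hlim] with i hi hd
    have : (fun c => c ∈ (L i).take (larPos (L i) (γC (p i)))) =
        (fun c => ∃ᶠ j in atTop, c ∈ γC (p j)) := by
      funext c
      rw [larAux_take _ (hord i), hd]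
      exact propext (hi c)
    rw [this]; rfl
  have prio : ∀ i, larPrio γC φ (p i, L i) = 2 * larPos (L i) (γC (p i)) ∧
        ELForm.sat (fun c => c ∈ (L i).take (larPos (L i) (γC (p i)))) φ ∨
      larPrio γC φ (p i, L i) = 2 * larPos (L i) (γC (p i)) + 1 ∧
        ¬ ELForm.sat (fun c => c ∈ (L i).take (larPos (L i) (γC (p i)))) φ := by
    intro i
    by_cases h : ELForm.sat (fun c => c ∈ (L i).take (larPos (L i) (γC (p i)))) φ
    · left; exact ⟨by simp [larPrio, h], h⟩
    · right; exact ⟨by simp [larPrio, h], h⟩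
  constructor
  · intro hw
    refine ⟨2 * m, by simp, ?_, ?_⟩
    · refine (hf.and_eventually key).mono ?_
      rintro i ⟨hd, hk⟩
      have hs := (hk hd).2 hw
      rcases prio i with ⟨h, _⟩ | ⟨_, h⟩
      · show larPrio γC φ (p i, L i) = _
        rw [h, hd]
      · exact absurd hs h
    · intro q hq
      filter_upwards [hle, key] with i hd hk
      rcases prio i with ⟨h, _⟩ | ⟨h, h'⟩
      · omega
      · have : larPos (L i) (γC (p i)) ≠ m := fun e => h' ((hk e).2 hw)
        omega
  · rintro ⟨q, hq, hqf, hqe⟩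
    by_contra hw
    have hfr : ∃ᶠ i in atTop, larPrio γC φ (p i, L i) = 2 * m + 1 := by
      refine (hf.and_eventually key).mono ?_
      rintro i ⟨hd, hk⟩
      have hs := fun h => hw ((hk hd).1 h)
      rcases prio i with ⟨_, h⟩ | ⟨h, _⟩
      · exact absurd h hs
      · rw [h, hd]
    have h1 : 2 * m + 1 ≤ q := by
      by_contra hlt
      exact hfr (hqe (2*m+1) (by omega))
    obtain ⟨i, hi, hd⟩ := (hqf.and_eventually hle).exists
    obtain ⟨r, hr⟩ := hq
    change larPrio γC φ (p i, L i) = q at hi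
    rcases prio i with ⟨h, _⟩ | ⟨h, _⟩ <;> omega

theorem histAux_succ {V : Type*} (p : ℕ → V) (n : ℕ) :
    histList p (n+1) = histList p n ++ [p n] := by
  unfold histList
  rw [List.ofFn_succ_last]
  simp

/-- Annotates a history with the records; second component is the current record. -/
def larAnnot {V C : Type*} [DecidableEq C] (γC : V → Finset C) (π0 : List C) (h : List V) :
    List (V × List C) × List C :=
  h.foldl (fun s u => (s.1 ++ [(u, s.2)], larUpd s.2 (γC u))) ([], π0)

theorem larAnnot_hist {V C : Type*} [DecidableEq C] (γC : V → Finset C) (π0 : List C)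
    (p : ℕ → V) (L : ℕ → List C) (h0 : L 0 = π0)
    (hL : ∀ i, L (i+1) = larUpd (L i) (γC (p i))) (n : ℕ) :
    larAnnot γC π0 (histList p n) = (histList (fun i => (p i, L i)) n, L n) := by
  induction n with
  | zero => simp [larAnnot, histList, h0]
  | succ n ih =>
    rw [histAux_succ, histAux_succ, hL]
    unfold larAnnot at ih ⊢
    rw [List.foldl_append, ih]
    simp

/-- Correctness of the economic later-appearance-record reduction: for an Emerson-Lei game
`G` over a finite set `C` of colors and any fixed initial permutation `π₀` of `C`,
a node `v` is won by player ∃ in `G` iff `(v,π₀)` is won by player ∃ in the parity game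
`P(G)`. -/
theorem statement5 {V C : Type*} [Fintype C] [DecidableEq C]
    (Vex : Set V) (E : V → Set V) (hNE : ∀ v : V, (E v).Nonempty)
    (γC : V → Finset C) (φ : ELForm C)
    (π0 : List C) (hπ0 : IsOrdering π0) (v : V) :
    WinsFrom Vex E (ELWinsPlay γC φ) v ↔
      WinsFrom (prodVex C Vex) (prodE E γC) (ParityWinsPlay (larPrio γC φ)) (v, π0) := by
  constructor
  · rintro ⟨σ, hσ, -, hwin⟩
    refine ⟨fun h q => (σ (h.map Prod.fst) q.1, larUpd q.2 (γC q.1)), ?_, ?_, ?_⟩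
    · intro h u hu _
      exact ⟨_, hσ _ _ hu (hNE _), rfl⟩
    · intro p n _ _ _ _
      obtain ⟨w, hw⟩ := hNE (p n).1
      exact ⟨_, w, hw, rfl⟩
    · intro P hP0 hPE hPs
      have hL : ∀ i, (P (i+1)).2 = larUpd (P i).2 (γC (P i).1) := by
        intro i
        obtain ⟨w, _, h⟩ := hPE i
        rw [h]
      have hmain := larAux_play γC φ (fun i => (P i).1) (fun i => (P i).2)
        (by simpa [hP0] using hπ0) hL
      refine hmain.1 (hwin _ (by simp [hP0]) ?_ ?_)
      · intro i
        obtain ⟨w, hw, h⟩ := hPE i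
        simpa [h] using hw
      · intro i hi
        have := congrArg Prod.fst (hPs i hi)
        simpa [histList, List.map_ofFn, Function.comp_def] using this
  · rintro ⟨σ, hσ, -, hwin⟩
    have hE' : ∀ q : V × List C, (prodE E γC q).Nonempty := by
      intro q
      obtain ⟨w, hw⟩ := hNE q.1
      exact ⟨_, w, hw, rfl⟩
    refine ⟨fun h u => (σ (larAnnot γC π0 h).1 (u, (larAnnot γC π0 h).2)).1, ?_, ?_, ?_⟩
    · intro h u hu _
      obtain ⟨w, hw, h⟩ := hσ (larAnnot γC π0 h).1 (u, (larAnnot γC π0 h).2) hu (hE' _)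
      simpa [h] using hw
    · intro p n _ _ _ _
      exact hNE _
    · intro p hp0 hpE hps
      let L : ℕ → List C := fun n => Nat.rec π0 (fun i l => larUpd l (γC (p i))) n
      have hL : ∀ i, L (i+1) = larUpd (L i) (γC (p i)) := fun i => rfl
      have hL0 : L 0 = π0 := rfl
      refine (larAux_play γC φ p L (by rw [hL0]; exact hπ0) hL).2 (hwin _ ?_ ?_ ?_)
      · show (p 0, L 0) = _
        rw [hp0, hL0]
      · intro i
        exact ⟨_, hpE i, rfl⟩
      · intro i hi
        have h := hps i hi
        simp only [larAnnot_hist γC π0 p L hL0 hL i] at h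
        obtain ⟨w, hw, h'⟩ := hσ (histList (fun i => (p i, L i)) i) (p i, L i) hi (hE' _)
        show (p (i+1), L (i+1)) = σ (histList (fun i => (p i, L i)) i) (p i, L i)
        rw [h'] at h ⊢
        rw [h, hL]
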